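/- Let G and H be groups, and let inr : H →* G ∗ H denote the canonical homomorphism of H into the free product. Then the image subgroup inr(H) has finite index in G ∗ H if and only if G is trivial, or H is trivial and G is finite. -/

import Mathlib

open Monoid

namespace Monoid

/-- The positive powers of a product of nontrivial elements from two distinct free factors
are represented by reduced words beginning in the first factor and ending in the second. -/
theorem CoprodI.exists_neWord_prod_eq_pow {ι : Type*} {M : ι → Type*} [∀ i, Monoid (M i)]
    {i j : ι} (hij : i ≠ j) {a : M i} {b : M j} (ha : a ≠ 1) (hb : b ≠ 1) (n : ℕ) :
    ∃ w : NeWord M i j, w.prod = (of a * of b) ^ (n + 1) := by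
  have base : ∃ w : NeWord M i j, w.prod = of a * of b :=
    ⟨(NeWord.singleton a ha).append hij (NeWord.singleton b hb), by simp⟩
  obtain ⟨v, hv⟩ := base
  induction n with
  | zero => exact ⟨v, by simp [hv]⟩
  | succ n ih =>
    obtain ⟨w, hw⟩ := ih
    exact ⟨w.append hij.symm v, by rw [NeWord.append_prod, hw, hv, ← pow_succ]⟩

/-- A reduced word beginning in one free factor and ending in another does not represent an
element of the latter factor. -/
theorem CoprodI.NeWord.prod_ne_of {ι : Type*} {M : ι → Type*} [∀ i, Monoid (M i)]
    {i j : ι} (hij : i ≠ j) (w : NeWord M i j) (x : M j) : w.prod ≠ of x := by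
  classical
  intro h
  by_cases hx : x = 1
  · have hw : w.toWord = Word.empty := Word.equiv.symm.injective (by
      change w.prod = Word.empty.prod
      simp [h, hx])
    exact w.toList_ne_nil (congrArg Word.toList hw)
  · have hw : w.toWord = (NeWord.singleton x hx).toWord := Word.equiv.symm.injective (by
      change w.prod = (NeWord.singleton x hx).prod
      simp [h])
    have hl : w.toList = (NeWord.singleton x hx).toList := congrArg Word.toList hw
    have hd := w.toList_head?
    rw [hl, NeWord.toList_head?] at hd
    exact hij (congrArg Sigma.fst (Option.some.inj hd)).symm

/-- No positive power of `inl g * inr h` with `g ≠ 1` and `h ≠ 1` lies in the second factor. -/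
theorem Coprod.inl_mul_inr_pow_ne_inr.{u, v} {G : Type u} {H : Type v} [Group G] [Group H]
    {g : G} {h : H} (hg : g ≠ 1) (hh : h ≠ 1) (n : ℕ) (x : H) :
    (inl g * inr h : Coprod G H) ^ (n + 1) ≠ inr x := by
  let M : Bool → Type (max u v) := fun b => cond b (ULift.{v} G) (ULift.{u} H)
  let : ∀ b, Group (M b) := fun b => match b with
    | true => (ULift.group : Group (ULift.{v} G))
    | false => (ULift.group : Group (ULift.{u} H))
  let f : G →* M true := (MulEquiv.ulift (α := G)).symm.toMonoidHom
  let k : H →* M false := (MulEquiv.ulift (α := H)).symm.toMonoidHom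
  have hf : f g ≠ 1 := fun e => hg (congrArg ULift.down e)
  have hk : k h ≠ 1 := fun e => hh (congrArg ULift.down e)
  obtain ⟨w, hw⟩ := CoprodI.exists_neWord_prod_eq_pow (by decide) hf hk n
  intro e
  refine w.prod_ne_of (by decide) (k x) ?_
  have e' := congrArg (Coprod.lift (CoprodI.of.comp f) (CoprodI.of.comp k)) e
  simpa [hw] using e'

end Monoid

/-- In a free product `G ∗ H`, the image of the canonical homomorphism
`inr : H →* G ∗ H` has finite index if and only if `G` is trivial, or
`H` is trivial and `G` is finite. -/
theorem Monoid.Coprod.finiteIndex_range_inr_iff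
    (G H : Type*) [Group G] [Group H] :
    (MonoidHom.range (Coprod.inr : H →* Coprod G H)).FiniteIndex ↔
      Subsingleton G ∨ (Subsingleton H ∧ Finite G) := by
  have hsup := Coprod.range_inl_sup_range_inr (G := G) (H := H)
  constructor
  · intro hfin
    refine or_iff_not_imp_left.mpr fun hG => ⟨?_, ?_⟩
    · rw [not_subsingleton_iff_nontrivial] at hG
      obtain ⟨g, hg⟩ := exists_ne (1 : G)
      refine subsingleton_of_forall_eq 1 fun h => by_contra fun hh => ?_
      obtain ⟨n, hn, -, x, hx⟩ := Subgroup.exists_pow_mem_of_index_ne_zero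
        hfin.index_ne_zero (Coprod.inl g * Coprod.inr h)
      obtain ⟨m, rfl⟩ := Nat.exists_eq_add_of_lt hn
      rw [zero_add] at hx
      exact Coprod.inl_mul_inr_pow_ne_inr hg hh m x hx.symm
    · have hle : (Coprod.inr : H →* Coprod G H).range ≤ (Coprod.fst : Coprod G H →* G).ker := by
        rintro _ ⟨x, rfl⟩
        simp [MonoidHom.mem_ker]
      have := Subgroup.finiteIndex_of_le hle
      exact Finite.of_equiv _ (QuotientGroup.quotientKerEquivOfSurjective _
        (Coprod.fst_surjective (M := G) (N := H))).toEquiv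
  · rintro (hG | ⟨hH, hG⟩)
    · have hbot : (Coprod.inl : G →* Coprod G H).range = ⊥ := by
        rw [MonoidHom.range_eq_bot_iff]
        ext x
        simp [Subsingleton.elim x 1]
      rw [hbot, bot_sup_eq] at hsup
      rw [hsup]
      infer_instance
    · have hbot : (Coprod.inr : H →* Coprod G H).range = ⊥ := by
        rw [MonoidHom.range_eq_bot_iff]
        ext x
        simp [Subsingleton.elim x 1]
      rw [hbot, sup_bot_eq] at hsup
      have := Finite.of_surjective _ (MonoidHom.range_eq_top.mp hsup)
      infer_instance
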